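/- arXiv:2105.07737 — 7 statements merged into one kernel-verified Lean document; each statement's English description precedes it below -/
import Mathlib

section
/- For every δ > 0 there exists a constant c_δ > 0 such that Φ_θ(r) ≥ c_δ · tan θ for all r > R₁ + δ and all θ with δ < θ < π/2. -/
/-- The weight function `Φ_θ(r) := inf_{t ≥ 0} |Im((1 + i f_θ'(r)) √(1 - t/(r + i f_θ(r))²))|`,
where `f_θ(r) = f(r) tan θ` and the square root is the principal branch (complex power `1/2`). -/
noncomputable def Phi (f f' : ℝ → ℝ) (θ r : ℝ) : ℝ :=
  ⨅ t : {t : ℝ // 0 ≤ t},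
    |(((1 : ℂ) + Complex.I * ((f' r * Real.tan θ : ℝ) : ℂ)) *
        (((1 : ℂ) - ((t : ℝ) : ℂ) / (((r : ℝ) : ℂ) + Complex.I * ((f r * Real.tan θ : ℝ) : ℂ)) ^ 2)
          ^ ((1 : ℂ) / 2))).im|

open Set in
/-- A function continuous and positive on `[A, ∞)` that equals `1` on `(B, ∞)` is bounded below
there by a positive constant. -/
lemma exists_pos_lower_bound_of_eq_one_eventually {g : ℝ → ℝ} {A B : ℝ}
    (hg : ContinuousOn g (Ici A)) (hpos : ∀ r, A ≤ r → 0 < g r) (hone : ∀ r, B < r → g r = 1) :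
    ∃ m : ℝ, 0 < m ∧ ∀ r, A ≤ r → m ≤ g r := by
  obtain ⟨x, hx, hmin⟩ := (isCompact_Icc (a := A) (b := max A B)).exists_isMinOn
    (nonempty_Icc.2 (le_max_left A B)) (hg.mono Icc_subset_Ici_self)
  refine ⟨min (g x) 1, lt_min (hpos x hx.1) one_pos, fun r hr => ?_⟩
  rcases le_or_gt r B with h | h
  · exact (min_le_left _ _).trans (hmin ⟨hr, h.trans (le_max_right A B)⟩)
  · exact (min_le_right _ _).trans (hone r h).ge

lemma one_sub_div_sq_re (r y t : ℝ) :
    (1 - (t : ℂ) / ((r : ℂ) + Complex.I * (y : ℂ)) ^ 2).re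
      = 1 - t * (r ^ 2 - y ^ 2) / (r ^ 2 + y ^ 2) ^ 2 := by
  have h : Complex.normSq (((r : ℂ) + Complex.I * (y : ℂ)) ^ 2) = (r ^ 2 + y ^ 2) ^ 2 := by
    simp [Complex.normSq_apply, pow_two]
    ring
  rw [Complex.sub_re, Complex.div_re, h]
  simp [pow_two]

lemma one_sub_div_sq_im (r y t : ℝ) :
    (1 - (t : ℂ) / ((r : ℂ) + Complex.I * (y : ℂ)) ^ 2).im
      = 2 * t * r * y / (r ^ 2 + y ^ 2) ^ 2 := by
  have h : Complex.normSq (((r : ℂ) + Complex.I * (y : ℂ)) ^ 2) = (r ^ 2 + y ^ 2) ^ 2 := by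
    simp [Complex.normSq_apply, pow_two]
    ring
  rw [Complex.sub_im, Complex.div_im, h]
  simp [pow_two]
  ring

/-- The distance from the origin to the line `t ↦ 1 - t / z ^ 2` is `|sin (2 arg z)|`, which is at
least `tan (arg z)` when `0 < arg z ≤ π / 4`. -/
lemma div_le_norm_one_sub_div_sq {r y : ℝ} (hr : 0 < r) (hy : 0 ≤ y) (hyr : y ≤ r) (t : ℝ) :
    y / r ≤ ‖1 - (t : ℂ) / ((r : ℂ) + Complex.I * (y : ℂ)) ^ 2‖ := by
  have hN : 0 < r ^ 2 + y ^ 2 := by positivity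
  have h1 : y / r ≤ 2 * r * y / (r ^ 2 + y ^ 2) := by
    rw [div_le_div_iff₀ hr hN]
    nlinarith [mul_nonneg hy (sub_nonneg.2 (pow_le_pow_left₀ hy hyr 2))]
  refine h1.trans (abs_le_of_sq_le_sq' ?_ (norm_nonneg _)).2
  rw [Complex.sq_norm, Complex.normSq_apply, one_sub_div_sq_re, one_sub_div_sq_im, ← sub_nonneg]
  have h2 : (1 - t * (r ^ 2 - y ^ 2) / (r ^ 2 + y ^ 2) ^ 2)
        * (1 - t * (r ^ 2 - y ^ 2) / (r ^ 2 + y ^ 2) ^ 2)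
      + 2 * t * r * y / (r ^ 2 + y ^ 2) ^ 2 * (2 * t * r * y / (r ^ 2 + y ^ 2) ^ 2)
      - (2 * r * y / (r ^ 2 + y ^ 2)) ^ 2 = ((t - (r ^ 2 - y ^ 2)) / (r ^ 2 + y ^ 2)) ^ 2 := by
    field_simp
    ring
  rw [h2]
  positivity

lemma sqrt_norm_le_re_add_im_cpow_inv_two {w : ℂ} (hw : 0 ≤ w.im) :
    √‖w‖ ≤ (w ^ (2⁻¹ : ℂ)).re + (w ^ (2⁻¹ : ℂ)).im := by
  rw [Complex.cpow_inv_two_re, Complex.cpow_inv_two_im_eq_sqrt hw]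
  have hre := abs_le.1 (Complex.abs_re_le_norm w)
  have h1 := Real.sq_sqrt (show 0 ≤ (‖w‖ + w.re) / 2 by linarith)
  have h2 := Real.sq_sqrt (show 0 ≤ (‖w‖ - w.re) / 2 by linarith)
  refine Real.sqrt_le_iff.2 ⟨by positivity, ?_⟩
  nlinarith [mul_nonneg (Real.sqrt_nonneg ((‖w‖ + w.re) / 2))
    (Real.sqrt_nonneg ((‖w‖ - w.re) / 2))]

/-- Pointwise lower bound behind `phi_lower_bound_tan`, with `a = f r`, `p = f' r`,
`T = tan θ`. -/
lemma le_im_mul_cpow_inv_two {m p₀ δ r a p T t : ℝ} (hm : 0 < m) (hp₀ : 0 < p₀) (hδ : 0 < δ)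
    (hr : 0 < r) (ha : m ≤ a / r) (hp : p₀ ≤ p) (hT : δ ≤ T) (ht : 0 ≤ t) :
    min p₀ (min 1 (p₀ * δ) * √(m * δ) * m) * T ≤
      ((1 + Complex.I * ((p * T : ℝ) : ℂ)) *
        (1 - (t : ℂ) / ((r : ℂ) + Complex.I * ((a * T : ℝ) : ℂ)) ^ 2) ^ (2⁻¹ : ℂ)).im := by
  have hT0 : 0 < T := hδ.trans_le hT
  have hpT0 : 0 ≤ p * T := mul_nonneg (hp₀.le.trans hp) hT0.le
  have hmr : m * r ≤ a := (le_div_iff₀ hr).1 ha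
  have ha0 : 0 < a := (mul_pos hm hr).trans_le hmr
  have hre := one_sub_div_sq_re r (a * T) t
  have him := one_sub_div_sq_im r (a * T) t
  have hnorm := div_le_norm_one_sub_div_sq hr (mul_pos ha0 hT0).le (t := t)
  set w : ℂ := 1 - (t : ℂ) / ((r : ℂ) + Complex.I * ((a * T : ℝ) : ℂ)) ^ 2
  have hw : 0 ≤ w.im := by rw [him]; positivity
  have hsum := sqrt_norm_le_re_add_im_cpow_inv_two hw
  have hu : (w ^ (2⁻¹ : ℂ)).re = _ := Complex.cpow_inv_two_re w
  have hv : (w ^ (2⁻¹ : ℂ)).im = _ := Complex.cpow_inv_two_im_eq_sqrt hw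
  have hu0 : 0 ≤ (w ^ (2⁻¹ : ℂ)).re := hu ▸ Real.sqrt_nonneg _
  have hv0 : 0 ≤ (w ^ (2⁻¹ : ℂ)).im := hv ▸ Real.sqrt_nonneg _
  have hexp : ((1 + Complex.I * ((p * T : ℝ) : ℂ)) * w ^ (2⁻¹ : ℂ)).im
      = (w ^ (2⁻¹ : ℂ)).im + p * T * (w ^ (2⁻¹ : ℂ)).re := by
    simp [Complex.mul_im]
  rw [hexp]
  set u := (w ^ (2⁻¹ : ℂ)).re
  set v := (w ^ (2⁻¹ : ℂ)).im
  rcases le_total r (a * T) with h | h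
  · have hre1 : 1 ≤ w.re := by
      have : r ^ 2 ≤ (a * T) ^ 2 := pow_le_pow_left₀ hr.le h 2
      have : t * (r ^ 2 - (a * T) ^ 2) / (r ^ 2 + (a * T) ^ 2) ^ 2 ≤ 0 :=
        div_nonpos_of_nonpos_of_nonneg
          (mul_nonpos_of_nonneg_of_nonpos ht (by linarith)) (by positivity)
      linarith
    have hu1 : 1 ≤ u := by
      rw [hu, Real.one_le_sqrt]
      linarith [Complex.re_le_norm w]
    calc _ ≤ p₀ * T := by gcongr; exact min_le_left _ _
      _ ≤ p * T * 1 := by rw [mul_one]; gcongr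
      _ ≤ p * T * u := by gcongr
      _ ≤ v + p * T * u := by linarith
  · have hmT : m * T ≤ a * T / r := by
      rw [le_div_iff₀ hr]
      nlinarith
    have hmT1 : m * T ≤ 1 := hmT.trans ((div_le_one hr).2 h)
    have hκ : √(m * δ) ≤ √‖w‖ :=
      Real.sqrt_le_sqrt (((mul_le_mul_of_nonneg_left hT hm.le).trans hmT).trans (hnorm h))
    have hμ : 0 < min 1 (p₀ * δ) := by positivity
    have hpT : min 1 (p₀ * δ) ≤ p * T :=
      (min_le_right _ _).trans (mul_le_mul hp hT hδ.le (hp₀.le.trans hp))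
    calc _ ≤ min 1 (p₀ * δ) * √(m * δ) * m * T := by gcongr; exact min_le_right _ _
      _ = min 1 (p₀ * δ) * √(m * δ) * (m * T) := by ring
      _ ≤ min 1 (p₀ * δ) * √(m * δ) * 1 := by gcongr
      _ ≤ min 1 (p₀ * δ) * (u + v) := by rw [mul_one]; gcongr; exact hκ.trans hsum
      _ = min 1 (p₀ * δ) * v + min 1 (p₀ * δ) * u := by ring
      _ ≤ 1 * v + p * T * u := by gcongr; exact min_le_left _ _
      _ = v + p * T * u := by ring

theorem phi_lower_bound_tan
    (R₁ R₂ : ℝ) (hR₁ : 0 < R₁) (hR₁₂ : R₁ < R₂)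
    (f f' : ℝ → ℝ)
    (hderiv : ∀ r, 0 ≤ r → HasDerivAt f (f' r) r)
    (hf'cont : ContinuousOn f' (Set.Ici 0))
    (hf0 : ∀ r, 0 ≤ r → (f r = 0 ↔ r ≤ R₁))
    (hf'0 : ∀ r, 0 ≤ r → (f' r = 0 ↔ r ≤ R₁))
    (hf'nonneg : ∀ r, 0 ≤ r → 0 ≤ f' r)
    (hflin : ∀ r, R₂ ≤ r → f r = r) :
    ∀ δ : ℝ, 0 < δ → ∃ c : ℝ, 0 < c ∧
      ∀ r : ℝ, R₁ + δ < r → ∀ θ : ℝ, δ < θ → θ < Real.pi / 2 →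
        c * Real.tan θ ≤ Phi f f' θ r := by
  intro δ hδ
  have hmono : MonotoneOn f (Set.Ici 0) :=
    monotoneOn_of_hasDerivWithinAt_nonneg (convex_Ici 0)
      (fun r hr => (hderiv r hr).continuousAt.continuousWithinAt)
      (fun r hr => (hderiv r (interior_subset hr)).hasDerivWithinAt)
      (fun r hr => hf'nonneg r (interior_subset hr))
  have hfpos : ∀ r, R₁ + δ ≤ r → 0 < f r := fun r hr => by
    have h0 : 0 ≤ r := by linarith
    have h1 : f R₁ = 0 := (hf0 R₁ hR₁.le).2 le_rfl
    refine lt_of_le_of_ne (h1 ▸ hmono hR₁.le h0 (by linarith)) fun h => ?_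
    linarith [(hf0 r h0).1 h.symm]
  obtain ⟨m, hm, hfm⟩ := exists_pos_lower_bound_of_eq_one_eventually
    (g := fun r => f r / r) (A := R₁ + δ) (B := R₂)
    (fun r hr => by
      have h0 : 0 < r := by linarith [Set.mem_Ici.1 hr]
      exact ((hderiv r h0.le).continuousAt.div continuousAt_id h0.ne').continuousWithinAt)
    (fun r hr => div_pos (hfpos r hr) (by linarith))
    (fun r hr => by rw [hflin r hr.le, div_self (by linarith)])
  obtain ⟨p₀, hp₀, hf'p⟩ := exists_pos_lower_bound_of_eq_one_eventually
    (g := f') (A := R₁ + δ) (B := R₂)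
    (hf'cont.mono (Set.Ici_subset_Ici.2 (by linarith)))
    (fun r hr => by
      have h0 : 0 ≤ r := by linarith
      refine lt_of_le_of_ne (hf'nonneg r h0) fun h => ?_
      linarith [(hf'0 r h0).1 h.symm])
    (fun r hr => by
      refine (hderiv r (by linarith)).unique ((hasDerivAt_id r).congr_of_eventuallyEq ?_)
      filter_upwards [Ioi_mem_nhds hr] with s hs using hflin s (le_of_lt hs))
  refine ⟨min p₀ (min 1 (p₀ * δ) * √(m * δ) * m), by positivity, fun r hr θ hθ hθ' => ?_⟩
  have : Nonempty {t : ℝ // 0 ≤ t} := ⟨⟨0, le_rfl⟩⟩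
  refine le_ciInf fun t => le_trans ?_ (le_abs_self _)
  rw [one_div]
  exact le_im_mul_cpow_inv_two hm hp₀ hδ (by linarith) (hfm r hr.le) (hf'p r hr.le)
    (hθ.le.trans (Real.lt_tan (hδ.trans hθ) hθ').le) t.2
end

section
/- For every r > R₁ and every θ ∈ (0, π/2), one has Φ_θ(r) = f_θ′(r) if and only if tan²θ ≥ r²/f(r)² − 2r/(f′(r)·f(r)). (Note that f(r) > 0 and f′(r) > 0 for r > R₁, so the right-hand side is well defined.) -/
open Complex in
theorem re_cpow_half_nonneg (w : ℂ) : 0 ≤ (w ^ ((1 : ℂ) / 2)).re := by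
  rcases eq_or_ne w 0 with rfl | hw
  · simp
  rw [cpow_def_of_ne_zero hw, exp_re]
  refine mul_nonneg (Real.exp_pos _).le (Real.cos_nonneg_of_mem_Icc ?_)
  have him : (log w * (1 / 2)).im = arg w / 2 := by
    rw [show (log w * (1 / 2) : ℂ) = log w * ((1 / 2 : ℝ) : ℂ) by push_cast; ring, im_mul_ofReal,
      log_im]
    ring
  rw [him]
  constructor <;> linarith [neg_pi_lt_arg w, arg_le_pi w]

open Complex in
theorem cpow_half_sq (w : ℂ) : (w ^ ((1 : ℂ) / 2)) ^ 2 = w := by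
  simp

open Complex in
theorem sq_cpow_half {v : ℂ} (hv : 0 < v.re) : (v ^ 2) ^ ((1 : ℂ) / 2) = v := by
  have harg := abs_lt.1 (abs_arg_lt_pi_div_two_iff.2 (Or.inl hv))
  simpa using pow_cpow_nat_inv (x := v) two_ne_zero (by simpa [neg_div] using harg.1)
    (by simpa using harg.2.le)

/-- A parametrization of `1 - t / (r + i b)²` by its square root `p + i q`. -/
theorem one_sub_div_sq_eq_sq_iff {r b : ℝ} (hr : 0 < r) (hb : 0 < b) (t p q : ℝ) :
    (1 : ℂ) - (t : ℂ) / ((r : ℂ) + Complex.I * (b : ℂ)) ^ 2 = ((p : ℂ) + Complex.I * q) ^ 2 ↔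
      p * q * (r ^ 2 + b ^ 2) ^ 2 = t * (r * b) ∧
        r * b * (p ^ 2 - q ^ 2 - 1) = -(r ^ 2 - b ^ 2) * (p * q) := by
  have hρ : 0 < r ^ 2 + b ^ 2 := by positivity
  have hrb : 0 < r * b := by positivity
  have hz : (r : ℂ) + Complex.I * (b : ℂ) ≠ 0 := by
    intro h
    have := congrArg Complex.re h
    simp at this
    exact hr.ne' this
  have hz2 := pow_ne_zero 2 hz
  have key : (1 : ℂ) - (t : ℂ) / ((r : ℂ) + Complex.I * (b : ℂ)) ^ 2
        = ((p : ℂ) + Complex.I * q) ^ 2 ↔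
      (r ^ 2 - b ^ 2 - t = (p ^ 2 - q ^ 2) * (r ^ 2 - b ^ 2) - 4 * (p * q) * (r * b)) ∧
      (2 * (r * b) = (p ^ 2 - q ^ 2) * (2 * (r * b)) + 2 * (p * q) * (r ^ 2 - b ^ 2)) := by
    rw [sub_eq_iff_eq_add, ← sub_eq_iff_eq_add', eq_div_iff hz2, Complex.ext_iff]
    simp [pow_two]
    constructor <;> rintro ⟨h₁, h₂⟩ <;> constructor <;> linarith
  rw [key]
  constructor
  · rintro ⟨h₁, h₂⟩
    have h₃ : r * b * (p ^ 2 - q ^ 2 - 1) = -(r ^ 2 - b ^ 2) * (p * q) := by linarith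
    refine ⟨?_, h₃⟩
    linear_combination (r * b) * h₁ + (r ^ 2 - b ^ 2) * h₃
  · rintro ⟨h₁, h₂⟩
    refine ⟨mul_left_cancel₀ hrb.ne' ?_, by linarith⟩
    linear_combination h₁ - (r ^ 2 - b ^ 2) * h₂

/-- The infimum defining `Phi`, in terms of `a = f_θ'(r)` and `b = f_θ(r)`. -/
theorem iInf_abs_im_eq_iff {r a b : ℝ} (hr : 0 < r) (ha : 0 < a) (hb : 0 < b) :
    (⨅ t : {t : ℝ // 0 ≤ t}, |(((1 : ℂ) + Complex.I * (a : ℂ)) *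
        (((1 : ℂ) - ((t : ℝ) : ℂ) / ((r : ℂ) + Complex.I * (b : ℂ)) ^ 2) ^ ((1 : ℂ) / 2))).im|) = a ↔
      a * (r ^ 2 - b ^ 2) ≤ 2 * (r * b) := by
  have hrb : 0 < r * b := by positivity
  have hbdd : BddBelow (Set.range fun t : {t : ℝ // 0 ≤ t} =>
      |(((1 : ℂ) + Complex.I * (a : ℂ)) *
        (((1 : ℂ) - ((t : ℝ) : ℂ) / ((r : ℂ) + Complex.I * (b : ℂ)) ^ 2) ^ ((1 : ℂ) / 2))).im|) :=
    ⟨0, by rintro _ ⟨t, rfl⟩; exact abs_nonneg _⟩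
  constructor
  · intro h
    by_contra! hlt
    obtain ⟨c, hc⟩ : ∃ c, c = (r ^ 2 - b ^ 2) / (r * b) := ⟨_, rfl⟩
    have hc' : c * (r * b) = r ^ 2 - b ^ 2 := by rw [hc]; field_simp
    have hac : 2 / a < c := by
      rw [hc, div_lt_div_iff₀ ha hrb]
      linarith
    obtain ⟨m, hm₁, hm₂⟩ : ∃ m, 1 / a < m ∧ m < c / 2 :=
      exists_between (by rw [lt_div_iff₀ two_pos]; linarith [show 1 / a * 2 = 2 / a by ring])
    have hm : 0 < m := lt_trans (by positivity) hm₁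
    have ham : 1 < a * m := by
      rw [div_lt_iff₀ ha] at hm₁
      linarith
    have hD : 0 < 1 + c * m - m ^ 2 := by nlinarith
    obtain ⟨q, hq⟩ : ∃ q, q = (c - 2 * m) / (1 + c * m - m ^ 2) := ⟨_, rfl⟩
    have hq₀ : 0 < q := by rw [hq]; exact div_pos (by linarith) hD
    have hq₁ : q * (1 + c * m - m ^ 2) = c - 2 * m := by rw [hq]; field_simp
    have hp₀ : 0 < 1 - m * q := by
      refine pos_of_mul_pos_left (b := 1 + c * m - m ^ 2) ?_ hD.le
      nlinarith
    have ht : 0 ≤ (1 - m * q) * q * (r ^ 2 + b ^ 2) ^ 2 / (r * b) := by positivity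
    have hsq := (one_sub_div_sq_eq_sq_iff hr hb
      ((1 - m * q) * q * (r ^ 2 + b ^ 2) ^ 2 / (r * b)) (1 - m * q) q).2
        ⟨by field_simp, by linear_combination (-(r * b) * q) * hq₁ - (1 - m * q) * q * hc'⟩
    have hle := ciInf_le hbdd ⟨_, ht⟩
    rw [h] at hle
    simp only at hle
    rw [hsq, sq_cpow_half (by simpa using hp₀)] at hle
    have him : (((1 : ℂ) + Complex.I * (a : ℂ)) *
        (((1 - m * q : ℝ) : ℂ) + Complex.I * (q : ℂ))).im = q + a * (1 - m * q) := by
      simp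
    rw [him, abs_of_pos (by positivity)] at hle
    nlinarith
  · intro h
    refine le_antisymm ?_ (le_ciInf ?_)
    · refine (ciInf_le hbdd ⟨0, le_rfl⟩).trans ?_
      simp [abs_of_pos ha]
    · rintro ⟨t, ht⟩
      simp only
      refine le_trans ?_ (le_abs_self _)
      set v := ((1 : ℂ) - (t : ℂ) / ((r : ℂ) + Complex.I * (b : ℂ)) ^ 2) ^ ((1 : ℂ) / 2) with hv
      have hp : 0 ≤ v.re := re_cpow_half_nonneg _
      have hsq : (1 : ℂ) - (t : ℂ) / ((r : ℂ) + Complex.I * (b : ℂ)) ^ 2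
          = ((v.re : ℂ) + Complex.I * v.im) ^ 2 := by
        rw [mul_comm Complex.I (v.im : ℂ), Complex.re_add_im, hv, cpow_half_sq]
      obtain ⟨h₁, h₂⟩ := (one_sub_div_sq_eq_sq_iff hr hb t v.re v.im).1 hsq
      have him : (((1 : ℂ) + Complex.I * (a : ℂ)) * v).im = v.im + a * v.re := by
        simp
      rw [him]
      generalize v.re = p at *
      generalize v.im = q at *
      have hp₀ : 0 < p := by
        refine lt_of_le_of_ne hp fun hp₀ => ?_
        rw [← hp₀] at h₂
        nlinarith [mul_nonneg hrb.le (sq_nonneg q)]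
      have hq : 0 ≤ q := by
        have : 0 ≤ q * (p * (r ^ 2 + b ^ 2) ^ 2) := by
          have : 0 ≤ t * (r * b) := by positivity
          linarith
        exact nonneg_of_mul_nonneg_left this (by positivity)
      by_contra! hlt
      have hp₁ : p < 1 := by
        by_contra! hp₁
        nlinarith
      have h₃ : a * (1 - p ^ 2 + q ^ 2) ≤ 2 * (p * q) := by
        refine le_of_mul_le_mul_left ?_ hrb
        nlinarith [mul_le_mul_of_nonneg_right h (mul_nonneg hp hq)]
      have h₄ : p * q ≤ p * (a * (1 - p)) :=
        mul_le_mul_of_nonneg_left (by linarith) hp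
      nlinarith [mul_pos ha (pow_pos (sub_pos.2 hp₁) 2), mul_nonneg ha.le (sq_nonneg q)]

theorem phi_eq_iff_tan_sq
    (R₁ R₂ : ℝ) (hR₁ : 0 < R₁) (hR₁₂ : R₁ < R₂)
    (f f' : ℝ → ℝ)
    (hderiv : ∀ r, 0 ≤ r → HasDerivAt f (f' r) r)
    (hf'cont : ContinuousOn f' (Set.Ici 0))
    (hf0 : ∀ r, 0 ≤ r → (f r = 0 ↔ r ≤ R₁))
    (hf'0 : ∀ r, 0 ≤ r → (f' r = 0 ↔ r ≤ R₁))
    (hf'nonneg : ∀ r, 0 ≤ r → 0 ≤ f' r)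
    (hflin : ∀ r, R₂ ≤ r → f r = r) :
    ∀ r : ℝ, R₁ < r → ∀ θ : ℝ, θ ∈ Set.Ioo 0 (Real.pi / 2) →
      (Phi f f' θ r = f' r * Real.tan θ ↔
        r ^ 2 / (f r) ^ 2 - 2 * r / (f' r * f r) ≤ Real.tan θ ^ 2) := by
  intro r hr θ hθ
  have hr₀ : 0 < r := hR₁.trans hr
  have hT : 0 < Real.tan θ := Real.tan_pos_of_pos_of_lt_pi_div_two hθ.1 hθ.2
  have hmono : MonotoneOn f (Set.Ici 0) := by
    refine monotoneOn_of_deriv_nonneg (convex_Ici 0)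
      (fun x hx => (hderiv x hx).continuousAt.continuousWithinAt) ?_ ?_
    · intro x hx
      exact (hderiv x (interior_subset hx)).differentiableAt.differentiableWithinAt
    · intro x hx
      rw [(hderiv x (interior_subset hx)).deriv]
      exact hf'nonneg x (interior_subset hx)
  have hf : 0 < f r := by
    refine lt_of_le_of_ne ?_ fun h => hr.not_ge ((hf0 r hr₀.le).1 h.symm)
    rw [← (hf0 0 le_rfl).2 hR₁.le]
    exact hmono Set.self_mem_Ici hr₀.le hr₀.le
  have hf' : 0 < f' r :=
    lt_of_le_of_ne (hf'nonneg r hr₀.le) fun h => hr.not_ge ((hf'0 r hr₀.le).1 h.symm)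
  rw [Phi, iInf_abs_im_eq_iff hr₀ (mul_pos hf' hT) (mul_pos hf hT)]
  have hdiff : f' r * f r ^ 2 * Real.tan θ *
      (Real.tan θ ^ 2 - (r ^ 2 / f r ^ 2 - 2 * r / (f' r * f r))) =
      2 * (r * (f r * Real.tan θ)) - f' r * Real.tan θ * (r ^ 2 - (f r * Real.tan θ) ^ 2) := by
    field_simp
    ring
  rw [← sub_nonneg, ← hdiff, mul_nonneg_iff_of_pos_left (by positivity), sub_nonneg]
end

section
/- If r > 0 is a point at which f(r) = r and f′(r) = 1 (in particular, any r > R₂), then for every θ ∈ (0, π/2) one has Φ_θ(r) = f_θ′(r) = tan θ. -/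
/-- Subtracting a nonnegative real from the square of `1 + i T` does not decrease the modulus of
the imaginary part of a square root. -/
theorem abs_le_abs_im_of_sq_eq {T s : ℝ} {w : ℂ}
    (hw : w ^ 2 = (1 + Complex.I * (T : ℂ)) ^ 2 - (s : ℂ)) (hs : 0 ≤ s) : |T| ≤ |w.im| := by
  have hre : w.re ^ 2 - w.im ^ 2 = 1 - T ^ 2 - s := by
    have h := congrArg Complex.re hw
    simp [pow_two] at h
    linarith
  have him : w.re * w.im = T := by
    have h := congrArg Complex.im hw
    simp [pow_two] at h
    linarith
  have key : 0 ≤ (w.im ^ 2 + 1) * (w.im ^ 2 - T ^ 2) := by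
    have h : (w.im ^ 2 + 1) * (w.im ^ 2 - T ^ 2) = s * w.im ^ 2 := by
      linear_combination (-w.im ^ 2) * hre + (w.re * w.im + T) * him
    rw [h]
    positivity
  have hpos : 0 < w.im ^ 2 + 1 := by positivity
  exact sq_le_sq.mp (sub_nonneg.mp (nonneg_of_mul_nonneg_right key hpos))

/-- The product of `1 + i T` with a square root of `1 - t / (r + i r T) ^ 2` has imaginary part of
modulus at least `|T|`. -/
theorem abs_le_abs_im_mul_cpow {T r t : ℝ} (hr : 0 < r) (ht : 0 ≤ t) :
    |T| ≤ |((1 + Complex.I * (T : ℂ)) *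
      ((1 - (t : ℂ) / ((r : ℂ) + Complex.I * ((r * T : ℝ) : ℂ)) ^ 2) ^ ((1 : ℂ) / 2))).im| := by
  apply abs_le_abs_im_of_sq_eq (s := t / r ^ 2) _ (by positivity)
  have ha : (1 + Complex.I * (T : ℂ)) ≠ 0 := by
    intro h
    simpa using congrArg Complex.re h
  have hrc : (r : ℂ) ≠ 0 := by exact_mod_cast hr.ne'
  have hfac : (r : ℂ) + Complex.I * ((r * T : ℝ) : ℂ) = r * (1 + Complex.I * (T : ℂ)) := by
    push_cast
    ring
  rw [mul_pow, one_div, show (2 : ℂ)⁻¹ = ((2 : ℕ) : ℂ)⁻¹ by norm_num,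
    Complex.cpow_nat_inv_pow _ two_ne_zero, hfac]
  push_cast
  field_simp


theorem phi_eq_tan_of_linear
    (R₁ R₂ : ℝ) (hR₁ : 0 < R₁) (hR₁₂ : R₁ < R₂)
    (f f' : ℝ → ℝ)
    (hderiv : ∀ r, 0 ≤ r → HasDerivAt f (f' r) r)
    (hf'cont : ContinuousOn f' (Set.Ici 0))
    (hf0 : ∀ r, 0 ≤ r → (f r = 0 ↔ r ≤ R₁))
    (hf'0 : ∀ r, 0 ≤ r → (f' r = 0 ↔ r ≤ R₁))
    (hf'nonneg : ∀ r, 0 ≤ r → 0 ≤ f' r)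
    (hflin : ∀ r, R₂ ≤ r → f r = r) :
    ∀ r : ℝ, 0 < r → f r = r → f' r = 1 →
      ∀ θ : ℝ, θ ∈ Set.Ioo 0 (Real.pi / 2) →
        Phi f f' θ r = f' r * Real.tan θ ∧ f' r * Real.tan θ = Real.tan θ := by
  intro r hr hfr hf'r θ hθ
  have hT : 0 < Real.tan θ := Real.tan_pos_of_pos_of_lt_pi_div_two hθ.1 hθ.2
  refine ⟨?_, by rw [hf'r, one_mul]⟩
  rw [Phi, hf'r, hfr, one_mul]
  apply le_antisymm
  · refine (ciInf_le ⟨0, ?_⟩ ⟨0, le_rfl⟩).trans ?_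
    · rintro _ ⟨t, rfl⟩
      exact abs_nonneg _
    · simp [-Complex.ofReal_tan, abs_of_pos hT]
  · have : Nonempty {t : ℝ // 0 ≤ t} := ⟨⟨0, le_rfl⟩⟩
    refine le_ciInf fun t => ?_
    exact (le_abs_self _).trans (abs_le_abs_im_mul_cpow hr t.2)
end

section
/- For every δ > 0 there exists θ_δ ∈ (0, π/2) such that for all θ with θ_δ < θ < π/2 and all r ≥ R₁ + δ, one has Φ_θ(r) = f_θ′(r). -/
theorem one_le_re_cpow_half {u : ℂ} (hre : 1 ≤ u.re) :
    1 ≤ (u ^ ((1 : ℂ) / 2)).re := by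
  rw [one_div, Complex.cpow_inv_two_re]
  have := Complex.re_le_norm u
  exact Real.one_le_sqrt.mpr (by linarith)

theorem im_cpow_half_nonneg {u : ℂ} (him : 0 ≤ u.im) :
    0 ≤ (u ^ ((1 : ℂ) / 2)).im := by
  rw [one_div, Complex.cpow_inv_two_im_eq_sqrt him]
  positivity

theorem one_le_re_one_sub_div {v : ℂ} (hre : v.re ≤ 0) {t : ℝ} (ht : 0 ≤ t) :
    1 ≤ (1 - (t : ℂ) / v).re := by
  have h : (1 - (t : ℂ) / v).re = 1 + t * (-v.re / Complex.normSq v) := by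
    rw [div_eq_mul_inv, Complex.sub_re, Complex.re_ofReal_mul, Complex.inv_re, Complex.one_re]
    ring
  rw [h]
  have := mul_nonneg ht (div_nonneg (neg_nonneg.mpr hre) (Complex.normSq_nonneg v))
  linarith

theorem im_one_sub_div_nonneg {v : ℂ} (him : 0 ≤ v.im) {t : ℝ} (ht : 0 ≤ t) :
    0 ≤ (1 - (t : ℂ) / v).im := by
  have h : (1 - (t : ℂ) / v).im = t * (v.im / Complex.normSq v) := by
    rw [div_eq_mul_inv, Complex.sub_im, Complex.im_ofReal_mul, Complex.inv_im, Complex.one_im]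
    ring
  rw [h]
  exact mul_nonneg ht (div_nonneg him (Complex.normSq_nonneg v))

/-- Once the contour point `r + i f_θ(r)` lies in the sector `π/4 ≤ arg ≤ π/2`, the infimum defining
`Φ_θ(r)` is attained at `t = 0`. -/
theorem Phi_eq_of_le {f f' : ℝ → ℝ} {θ r : ℝ} (hr : 0 ≤ r) (hf : r ≤ f r * Real.tan θ)
    (hf' : 0 ≤ f' r * Real.tan θ) : Phi f f' θ r = f' r * Real.tan θ := by
  unfold Phi
  generalize f r * Real.tan θ = y at hf ⊢
  generalize f' r * Real.tan θ = g at hf' ⊢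
  have hvre : (((r : ℂ) + Complex.I * (y : ℂ)) ^ 2).re ≤ 0 := by
    simp [pow_two]
    nlinarith
  have hvim : 0 ≤ (((r : ℂ) + Complex.I * (y : ℂ)) ^ 2).im := by
    simp [pow_two]
    nlinarith
  have him (w : ℂ) : ((1 + Complex.I * (g : ℂ)) * w).im = w.im + g * w.re := by simp
  apply le_antisymm
  · refine (ciInf_le ⟨0, ?_⟩ (⟨0, le_rfl⟩ : {t : ℝ // 0 ≤ t})).trans_eq ?_
    · rintro _ ⟨t, rfl⟩
      exact abs_nonneg _
    · simp [abs_of_nonneg hf']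
  · have : Nonempty {t : ℝ // 0 ≤ t} := ⟨⟨0, le_rfl⟩⟩
    refine le_ciInf fun t => le_trans ?_ (le_abs_self _)
    rw [him]
    have hp := one_le_re_cpow_half (one_le_re_one_sub_div hvre t.2)
    have hq := im_cpow_half_nonneg (im_one_sub_div_nonneg hvim t.2)
    nlinarith [mul_le_mul_of_nonneg_left hp hf']

theorem phi_eq_deriv_for_steep_angles
    (R₁ R₂ : ℝ) (hR₁ : 0 < R₁) (hR₁₂ : R₁ < R₂)
    (f f' : ℝ → ℝ)
    (hderiv : ∀ r, 0 ≤ r → HasDerivAt f (f' r) r)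
    (hf'cont : ContinuousOn f' (Set.Ici 0))
    (hf0 : ∀ r, 0 ≤ r → (f r = 0 ↔ r ≤ R₁))
    (hf'0 : ∀ r, 0 ≤ r → (f' r = 0 ↔ r ≤ R₁))
    (hf'nonneg : ∀ r, 0 ≤ r → 0 ≤ f' r)
    (hflin : ∀ r, R₂ ≤ r → f r = r) :
    ∀ δ : ℝ, 0 < δ → ∃ θδ : ℝ, θδ ∈ Set.Ioo 0 (Real.pi / 2) ∧
      ∀ θ : ℝ, θδ < θ → θ < Real.pi / 2 →
        ∀ r : ℝ, R₁ + δ ≤ r → Phi f f' θ r = f' r * Real.tan θ := by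
  intro δ hδ
  have hmono : MonotoneOn f (Set.Ici 0) := by
    refine monotoneOn_of_deriv_nonneg (convex_Ici 0)
      (fun x hx => (hderiv x hx).continuousAt.continuousWithinAt) ?_ ?_
    · intro x hx
      exact (hderiv x (interior_subset hx)).differentiableAt.differentiableWithinAt
    · intro x hx
      rw [(hderiv x (interior_subset hx)).deriv]
      exact hf'nonneg x (interior_subset hx)
  have hc : 0 < f (R₁ + δ) := by
    have h0 : f R₁ = 0 := (hf0 R₁ hR₁.le).mpr le_rfl
    have hle : f R₁ ≤ f (R₁ + δ) :=
      hmono (Set.mem_Ici.mpr hR₁.le) (Set.mem_Ici.mpr (by linarith)) (by linarith)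
    have hne : f (R₁ + δ) ≠ 0 := fun h => by
      have := (hf0 (R₁ + δ) (by linarith)).mp h
      linarith
    exact lt_of_le_of_ne (h0 ▸ hle) hne.symm
  refine ⟨Real.arctan (max 1 (R₂ / f (R₁ + δ))),
    ⟨Real.arctan_pos.mpr (lt_max_of_lt_left one_pos), Real.arctan_lt_pi_div_two _⟩, ?_⟩
  intro θ hθ hθ' r hr
  have hT : max 1 (R₂ / f (R₁ + δ)) < Real.tan θ := by
    rw [← Real.tan_arctan (max 1 (R₂ / f (R₁ + δ)))]
    exact Real.tan_lt_tan_of_lt_of_lt_pi_div_two (Real.neg_pi_div_two_lt_arctan _) hθ' hθ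
  obtain ⟨hT1, hT2⟩ := max_lt_iff.mp hT
  have hr0 : 0 ≤ r := by linarith
  have hfr : f (R₁ + δ) ≤ f r :=
    hmono (Set.mem_Ici.mpr (by linarith)) (Set.mem_Ici.mpr hr0) hr
  refine Phi_eq_of_le hr0 ?_ (mul_nonneg (hf'nonneg r hr0) (by linarith))
  rcases le_total R₂ r with h | h
  · rw [hflin r h]
    nlinarith
  · rw [div_lt_iff₀ hc] at hT2
    nlinarith
end

section
/- For every r > 0, every θ ∈ (0, π/2), and every t ≥ 0, the quantity Ψ(t) := Im( (1 + i f_θ′(r)) · √(1 − t/(r + i f_θ(r))²) ) (principal square root) is nonnegative; moreover Ψ(t) → +∞ as t → +∞, and the infimum of Ψ over t ∈ [0, ∞) is attained at some t_m ≥ 0. Consequently Φ_θ(r) = min_{t ≥ 0} Ψ(t), and the absolute value in the definition of Φ_θ(r) is superfluous. -/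
/-- `Ψ(t) = Im((1 + i f_θ'(r)) √(1 - t/(r + i f_θ(r))²))` (no absolute value). -/
noncomputable def Psi (f f' : ℝ → ℝ) (θ r t : ℝ) : ℝ :=
  (((1 : ℂ) + Complex.I * ((f' r * Real.tan θ : ℝ) : ℂ)) *
      (((1 : ℂ) - ((t : ℝ) : ℂ) / (((r : ℝ) : ℂ) + Complex.I * ((f r * Real.tan θ : ℝ) : ℂ)) ^ 2)
        ^ ((1 : ℂ) / 2))).im

open Filter

/-- Closed form of `Im ((1 + i b) √w)` for `w` in the closed upper half-plane. -/
lemma im_one_add_I_mul_mul_cpow_half (b : ℝ) {w : ℂ} (hw : 0 ≤ w.im) :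
    (((1 : ℂ) + Complex.I * (b : ℂ)) * w ^ ((1 : ℂ) / 2)).im =
      √((‖w‖ - w.re) / 2) + b * √((‖w‖ + w.re) / 2) := by
  rw [one_div, ← Complex.cpow_inv_two_im_eq_sqrt hw, ← Complex.cpow_inv_two_re]
  simp

/-- If `η` lies in the open right half-plane, then `Im √(1 - t η²)` tends to infinity. -/
lemma tendsto_sqrt_norm_sub_re_atTop {η : ℂ} (hη : 0 < η.re) :
    Tendsto (fun t : ℝ => √((‖1 - (t : ℂ) * η ^ 2‖ - (1 - (t : ℂ) * η ^ 2).re) / 2))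
      atTop atTop := by
  refine Real.tendsto_sqrt_atTop.comp ?_
  have hlin : Tendsto (fun t : ℝ => t * η.re ^ 2 + -1) atTop atTop :=
    tendsto_atTop_add_const_right _ _ (tendsto_id.atTop_mul_const (by positivity))
  refine tendsto_atTop_mono' _ ?_ hlin
  filter_upwards [eventually_ge_atTop (0 : ℝ)] with t ht
  have hnorm : ‖(t : ℂ) * η ^ 2‖ = t * (η.re ^ 2 + η.im ^ 2) := by
    rw [norm_mul, norm_pow, Complex.sq_norm, Complex.normSq_apply, Complex.norm_real,
      Real.norm_of_nonneg ht]
    ring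
  have hre : (1 - (t : ℂ) * η ^ 2).re = 1 - t * (η.re ^ 2 - η.im ^ 2) := by
    simp [pow_two]
  have htri : ‖(t : ℂ) * η ^ 2‖ - 1 ≤ ‖1 - (t : ℂ) * η ^ 2‖ := by
    simpa only [norm_one, norm_sub_rev _ (1 : ℂ)] using norm_sub_norm_le ((t : ℂ) * η ^ 2) 1
  rw [hre]
  rw [hnorm] at htri
  linarith

lemma Psi_eq_sqrt_add_mul_sqrt {f f' : ℝ → ℝ} {θ r t : ℝ} {η : ℂ}
    (hη : η = ((r : ℂ) + Complex.I * ((f r * Real.tan θ : ℝ) : ℂ))⁻¹)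
    (hre : 0 ≤ η.re) (him : η.im ≤ 0) (ht : 0 ≤ t) :
    Psi f f' θ r t = √((‖1 - (t : ℂ) * η ^ 2‖ - (1 - (t : ℂ) * η ^ 2).re) / 2) +
      f' r * Real.tan θ * √((‖1 - (t : ℂ) * η ^ 2‖ + (1 - (t : ℂ) * η ^ 2).re) / 2) := by
  rw [← im_one_add_I_mul_mul_cpow_half, Psi, hη, inv_pow, div_eq_mul_inv (t : ℂ)]
  have h : (1 - (t : ℂ) * η ^ 2).im = 2 * t * (η.re * -η.im) := by
    simp [pow_two]
    ring
  rw [h]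
  have := mul_nonneg hre (neg_nonneg.2 him)
  positivity

theorem phi_infimum_attained
    (R₁ R₂ : ℝ) (hR₁ : 0 < R₁) (hR₁₂ : R₁ < R₂)
    (f f' : ℝ → ℝ)
    (hderiv : ∀ r, 0 ≤ r → HasDerivAt f (f' r) r)
    (hf'cont : ContinuousOn f' (Set.Ici 0))
    (hf0 : ∀ r, 0 ≤ r → (f r = 0 ↔ r ≤ R₁))
    (hf'0 : ∀ r, 0 ≤ r → (f' r = 0 ↔ r ≤ R₁))
    (hf'nonneg : ∀ r, 0 ≤ r → 0 ≤ f' r)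
    (hflin : ∀ r, R₂ ≤ r → f r = r) :
    ∀ r : ℝ, 0 < r → ∀ θ : ℝ, θ ∈ Set.Ioo 0 (Real.pi / 2) →
      (∀ t : ℝ, 0 ≤ t → 0 ≤ Psi f f' θ r t) ∧
      Filter.Tendsto (Psi f f' θ r) Filter.atTop Filter.atTop ∧
      ∃ tm : ℝ, 0 ≤ tm ∧ (∀ t : ℝ, 0 ≤ t → Psi f f' θ r tm ≤ Psi f f' θ r t) ∧
        Phi f f' θ r = Psi f f' θ r tm := by
  intro r hr θ hθ
  have htan : 0 < Real.tan θ := Real.tan_pos_of_pos_of_lt_pi_div_two hθ.1 hθ.2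
  have hb : 0 ≤ f' r * Real.tan θ := mul_nonneg (hf'nonneg r hr.le) htan.le
  have hfr : 0 ≤ f r := by
    have hmono : MonotoneOn f (Set.Ici 0) := by
      refine monotoneOn_of_hasDerivWithinAt_nonneg (f' := f') (convex_Ici 0)
        (fun x hx => (hderiv x hx).continuousAt.continuousWithinAt) ?_ ?_ <;>
      · intro x hx
        have hx0 : 0 ≤ x := interior_subset hx
        first
        | exact (hderiv x hx0).hasDerivWithinAt
        | exact hf'nonneg x hx0
    have h0 : f 0 = 0 := (hf0 0 le_rfl).2 hR₁.le
    exact h0 ▸ hmono (Set.mem_Ici.2 le_rfl) hr.le hr.le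
  have ha : 0 ≤ f r * Real.tan θ := mul_nonneg hfr htan.le
  obtain ⟨η, hη⟩ : ∃ η : ℂ, η = ((r : ℂ) + Complex.I * ((f r * Real.tan θ : ℝ) : ℂ))⁻¹ := ⟨_, rfl⟩
  have hre : 0 < η.re := by
    rw [hη, Complex.inv_re]
    refine div_pos (by simpa using hr) (Complex.normSq_pos.2 fun h => hr.ne' ?_)
    simpa using congrArg Complex.re h
  have him : η.im ≤ 0 := by
    rw [hη, Complex.inv_im]
    refine div_nonpos_of_nonpos_of_nonneg ?_ (Complex.normSq_nonneg _)
    simpa [-Complex.ofReal_mul] using ha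
  have hPsi : ∀ t : ℝ, 0 ≤ t → _ := fun t ht => Psi_eq_sqrt_add_mul_sqrt (f' := f') hη hre.le him ht
  have hnonneg : ∀ t : ℝ, 0 ≤ t → 0 ≤ Psi f f' θ r t := by
    intro t ht
    rw [hPsi t ht]
    positivity
  have htop : Tendsto (Psi f f' θ r) atTop atTop := by
    refine tendsto_atTop_mono' _ ?_ (tendsto_sqrt_norm_sub_re_atTop hre)
    filter_upwards [eventually_ge_atTop (0 : ℝ)] with t ht
    rw [hPsi t ht]
    exact le_add_of_nonneg_right (by positivity)
  have hcont : ContinuousOn (Psi f f' θ r) (Set.Ici 0) := by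
    refine ContinuousOn.congr (Continuous.continuousOn ?_) hPsi
    fun_prop
  obtain ⟨tm, htm, hmin⟩ : ∃ tm ∈ Set.Ici (0 : ℝ), IsMinOn (Psi f f' θ r) (Set.Ici 0) tm := by
    refine hcont.exists_isMinOn' isClosed_Ici (Set.mem_Ici.2 le_rfl) ?_
    rw [cocompact_eq_atBot_atTop, inf_sup_right, eventually_sup]
    refine ⟨?_, (htop.eventually_ge_atTop _).filter_mono inf_le_left⟩
    rw [eventually_inf_principal]
    filter_upwards [eventually_lt_atBot (0 : ℝ)] with t ht ht'
    exact absurd ht' (not_le.2 ht)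
  refine ⟨hnonneg, htop, tm, htm, fun t ht => hmin ht, ?_⟩
  have hPhi : Phi f f' θ r = ⨅ t : {t : ℝ // 0 ≤ t}, Psi f f' θ r t :=
    iInf_congr fun t => abs_of_nonneg (hnonneg t t.2)
  rw [hPhi]
  have : Nonempty {t : ℝ // 0 ≤ t} := ⟨⟨tm, htm⟩⟩
  refine le_antisymm (ciInf_le ⟨0, ?_⟩ (⟨tm, htm⟩ : {t : ℝ // 0 ≤ t})) (le_ciInf fun t => hmin t.2)
  rintro _ ⟨t, rfl⟩
  exact hnonneg t t.2
end

section
/- Let H be a complex Hilbert space and T : H → H a bounded self-adjoint operator which is positive semidefinite, i.e. ⟨Tv, v⟩ ≥ 0 for all v ∈ H. Then for every ε > 0 and every v ∈ H satisfying ⟨Tv, v⟩ ≤ ε‖v‖², one has ‖Tv‖² ≤ (1 + ‖T‖²) · ε^{2/3} · ‖v‖². -/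
open scoped InnerProductSpace

/-- A symmetric positive semidefinite bounded operator satisfies `‖Tv‖² ≤ ‖T‖ ⟨Tv, v⟩`. -/
theorem norm_sq_apply_le_opNorm_mul_re_inner
    {H : Type*} [NormedAddCommGroup H] [InnerProductSpace ℂ H]
    (T : H →L[ℂ] H)
    (hsa : ∀ v w : H, ⟪T v, w⟫_ℂ = ⟪v, T w⟫_ℂ)
    (hpos : ∀ v : H, 0 ≤ (⟪T v, v⟫_ℂ).re) (v : H) :
    ‖T v‖ ^ 2 ≤ ‖T‖ * (⟪T v, v⟫_ℂ).re := by
  rcases (norm_nonneg T).eq_or_lt with h0 | hM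
  · have hT : T = 0 := norm_eq_zero.mp h0.symm
    simp [hT]
  have hself : (⟪T v, T v⟫_ℂ).re = ‖T v‖ ^ 2 := inner_self_eq_norm_sq (𝕜 := ℂ) (T v)
  have hTT : (⟪T (T v), T v⟫_ℂ).re ≤ ‖T‖ * ‖T v‖ ^ 2 :=
    calc (⟪T (T v), T v⟫_ℂ).re ≤ ‖T (T v)‖ * ‖T v‖ := re_inner_le_norm (𝕜 := ℂ) _ _
      _ ≤ ‖T‖ * ‖T v‖ * ‖T v‖ := by gcongr; exact T.le_opNorm _
      _ = ‖T‖ * ‖T v‖ ^ 2 := by ring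
  have hw := hpos ((‖T‖ : ℂ) • v - T v)
  have hexpand : (⟪T ((‖T‖ : ℂ) • v - T v), (‖T‖ : ℂ) • v - T v⟫_ℂ).re =
      ‖T‖ ^ 2 * (⟪T v, v⟫_ℂ).re - 2 * ‖T‖ * ‖T v‖ ^ 2 + (⟪T (T v), T v⟫_ℂ).re := by
    simp only [map_sub, map_smul, inner_sub_left, inner_sub_right, inner_smul_left,
      inner_smul_right, hsa (T v) v, Complex.conj_ofReal, Complex.sub_re,
      Complex.re_ofReal_mul, hself]
    ring
  rw [hexpand] at hw
  refine le_of_mul_le_mul_left ?_ hM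
  linarith

/-- If `T` is a bounded self-adjoint positive semidefinite operator on a complex Hilbert
space and `⟨Tv, v⟩ ≤ ε‖v‖²`, then `‖Tv‖² ≤ (1 + ‖T‖²) ε^{2/3} ‖v‖²`. -/
theorem psd_smallness_transfer
    {H : Type*} [NormedAddCommGroup H] [InnerProductSpace ℂ H] [CompleteSpace H]
    (T : H →L[ℂ] H)
    (hsa : ∀ v w : H, ⟪T v, w⟫_ℂ = ⟪v, T w⟫_ℂ)
    (hpos : ∀ v : H, 0 ≤ (⟪T v, v⟫_ℂ).re) :
    ∀ ε : ℝ, 0 < ε → ∀ v : H, (⟪T v, v⟫_ℂ).re ≤ ε * ‖v‖ ^ 2 →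
      ‖T v‖ ^ 2 ≤ (1 + ‖T‖ ^ 2) * ε ^ ((2 : ℝ) / 3) * ‖v‖ ^ 2 := by
  intro ε hε v hv
  rcases le_total ε 1 with h1 | h1
  · have hpow : ε ≤ ε ^ ((2 : ℝ) / 3) := by
      simpa using Real.rpow_le_rpow_of_exponent_ge hε h1 (by norm_num : (2 : ℝ) / 3 ≤ 1)
    calc ‖T v‖ ^ 2 ≤ ‖T‖ * (⟪T v, v⟫_ℂ).re :=
          norm_sq_apply_le_opNorm_mul_re_inner T hsa hpos v
      _ ≤ ‖T‖ * (ε * ‖v‖ ^ 2) := by gcongr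
      _ = ‖T‖ * ε * ‖v‖ ^ 2 := by ring
      _ ≤ (1 + ‖T‖ ^ 2) * ε ^ ((2 : ℝ) / 3) * ‖v‖ ^ 2 := by
          gcongr
          nlinarith [sq_nonneg (‖T‖ - 1)]
  · have hpow : 1 ≤ ε ^ ((2 : ℝ) / 3) := Real.one_le_rpow h1 (by norm_num)
    calc ‖T v‖ ^ 2 ≤ (‖T‖ * ‖v‖) ^ 2 := by gcongr; exact T.le_opNorm v
      _ = ‖T‖ ^ 2 * 1 * ‖v‖ ^ 2 := by ring
      _ ≤ (1 + ‖T‖ ^ 2) * ε ^ ((2 : ℝ) / 3) * ‖v‖ ^ 2 := by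
          gcongr
          linarith
end

section
/- Structure of the characteristic set of the complex-scaled symbol: let B : ℝ^d → (real symmetric d×d matrices) be continuously differentiable with B(x) positive semidefinite for every x. For (x, ξ) ∈ ℝ^d × ℝ^d define the complex symbol p(x, ξ) := Σ_{j=1}^d ( ((I + iB(x))^{-1} ξ)_j )² (the bilinear, non-Hermitian, sum of squares of the components of (I + iB(x))^{-1}ξ ∈ ℂ^d), and set v := (I + B(x)²)^{-1} ξ ∈ ℝ^d. Then: (a) Re p(x,ξ) = |v|² − |B(x)v|² and Im p(x,ξ) = −2⟨B(x)v, v⟩; (b) if Im p(x,ξ) = 0, then B(x)v = 0 and v = ξ; (c) if moreover p(x,ξ) = 1, then |ξ| = 1, the gradient ∇_ξ Re p(x,ξ) = 2ξ, and the gradient ∇_x Re p(x,ξ) = 0. In particular, on the characteristic set {p = 1} the Hamiltonian vector field of Re p equals (2ξ, 0). -/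
open scoped Matrix

/-- The determinant of a matrix with differentiable entries is differentiable. -/
theorem DifferentiableAt.matrix_det {E : Type*} [NormedAddCommGroup E] [NormedSpace ℝ E]
    {n : Type*} [Fintype n] [DecidableEq n] {A : E → Matrix n n ℝ} {x : E}
    (hA : ∀ i j, DifferentiableAt ℝ (fun y => A y i j) x) :
    DifferentiableAt ℝ (fun y => (A y).det) x := by
  simp only [Matrix.det_apply']
  refine DifferentiableAt.fun_sum fun σ _ => DifferentiableAt.const_mul ?_ _
  fun_prop

/-- The inverse of an invertible matrix with differentiable entries has differentiable entries. -/
theorem DifferentiableAt.matrix_inv_apply {E : Type*} [NormedAddCommGroup E] [NormedSpace ℝ E]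
    {n : Type*} [Fintype n] [DecidableEq n] {A : E → Matrix n n ℝ} {x : E}
    (hA : ∀ i j, DifferentiableAt ℝ (fun y => A y i j) x) (hx : (A x).det ≠ 0) (i j : n) :
    DifferentiableAt ℝ (fun y => (A y)⁻¹ i j) x := by
  simp only [Matrix.inv_def, Matrix.smul_apply, Ring.inverse_eq_inv', smul_eq_mul,
    Matrix.adjugate_apply]
  refine ((DifferentiableAt.matrix_det hA).inv hx).mul (DifferentiableAt.matrix_det fun k l => ?_)
  by_cases hk : k = j
  · subst hk
    simp
  · simpa [Matrix.updateRow_ne hk] using hA k l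

/-- Matrix-vector products of differentiable families have differentiable components. -/
theorem DifferentiableAt.matrix_mulVec_apply {E : Type*} [NormedAddCommGroup E]
    [NormedSpace ℝ E] {m n : Type*} [Fintype n] {A : E → Matrix m n ℝ} {u : E → n → ℝ} {x : E}
    (hA : ∀ i j, DifferentiableAt ℝ (fun y => A y i j) x)
    (hu : ∀ j, DifferentiableAt ℝ (fun y => u y j) x) (i : m) :
    DifferentiableAt ℝ (fun y => (A y *ᵥ u y) i) x := by
  simp only [Matrix.mulVec, dotProduct]
  exact DifferentiableAt.fun_sum fun j _ => (hA i j).mul (hu j)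

/-- A sum of squares of differentiable functions has zero derivative where they all vanish. -/
theorem hasFDerivAt_sum_sq_zero {E : Type*} [NormedAddCommGroup E] [NormedSpace ℝ E]
    {n : Type*} [Fintype n] {w : E → n → ℝ} {x : E}
    (hw : ∀ j, DifferentiableAt ℝ (fun y => w y j) x) (hx : w x = 0) :
    HasFDerivAt (fun y => ∑ j, w y j ^ 2) (0 : E →L[ℝ] ℝ) x := by
  have h := HasFDerivAt.fun_sum (u := Finset.univ) fun j _ => (hw j).hasFDerivAt.pow 2
  refine h.congr_fderiv ?_
  simp [hx]

namespace Matrix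

variable {n : Type*} [Fintype n] [DecidableEq n] {B : Matrix n n ℝ}

theorem PosSemidef.posDef_one_add_sq (hB : B.PosSemidef) : (1 + B ^ 2).PosDef :=
  PosDef.one.add_posSemidef (hB.pow 2)

theorem PosSemidef.inv_one_add_sq_mulVec_add (hB : B.PosSemidef) (ξ : n → ℝ) :
    (1 + B ^ 2)⁻¹ *ᵥ ξ + B *ᵥ (B *ᵥ ((1 + B ^ 2)⁻¹ *ᵥ ξ)) = ξ := by
  have hu : IsUnit (1 + B ^ 2).det := hB.posDef_one_add_sq.det_pos.ne'.isUnit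
  have h : (1 + B ^ 2) *ᵥ ((1 + B ^ 2)⁻¹ *ᵥ ξ) = ξ := by
    rw [mulVec_mulVec, mul_nonsing_inv _ hu, one_mulVec]
  rwa [add_mulVec, one_mulVec, pow_two, ← mulVec_mulVec, ← pow_two] at h

/-- `(1 + iB)⁻¹ ξ = (1 - iB) v` when `v + B² v = ξ`. -/
theorem PosSemidef.inv_one_add_I_smul_mulVec (hB : B.PosSemidef) {ξ v : n → ℝ}
    (hv : v + B *ᵥ (B *ᵥ v) = ξ) :
    ((1 : Matrix n n ℂ) + Complex.I • B.map Complex.ofReal)⁻¹ *ᵥ (fun k => (ξ k : ℂ)) =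
      fun k => (v k : ℂ) - Complex.I * ((B *ᵥ v) k : ℂ) := by
  set C : Matrix n n ℂ := B.map Complex.ofReal with hC
  have hmap : (1 + B ^ 2).map Complex.ofReal = 1 + C ^ 2 := by
    change Complex.ofRealHom.mapMatrix (1 + B ^ 2) = 1 + (Complex.ofRealHom.mapMatrix B) ^ 2
    rw [map_add, map_one, map_pow]
  have hprod : (1 + Complex.I • C) * (1 - Complex.I • C) = 1 + C ^ 2 := by
    rw [mul_sub, add_mul, add_mul, smul_mul_smul_comm, Complex.I_mul_I, pow_two]
    simp only [mul_one, one_mul, neg_smul, one_smul]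
    abel
  have hdet : (1 + C ^ 2).det ≠ 0 := by
    rw [← hmap]
    change (Complex.ofRealHom.mapMatrix (1 + B ^ 2)).det ≠ 0
    rw [← RingHom.map_det]
    simpa using hB.posDef_one_add_sq.det_pos.ne'
  have hu : IsUnit (1 + Complex.I • C).det := by
    rw [← hprod, det_mul] at hdet
    exact (left_ne_zero_of_mul hdet).isUnit
  have hCv (u : n → ℝ) : C *ᵥ (fun k => (u k : ℂ)) = fun k => ((B *ᵥ u) k : ℂ) := by
    ext k
    simp [hC, mulVec, dotProduct]
  have key : (1 + Complex.I • C) *ᵥ (fun k => (v k : ℂ) - Complex.I * ((B *ᵥ v) k : ℂ)) =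
      fun k => (ξ k : ℂ) := by
    have hsplit : (fun k => (v k : ℂ) - Complex.I * ((B *ᵥ v) k : ℂ)) =
        (fun k => (v k : ℂ)) - Complex.I • fun k => ((B *ᵥ v) k : ℂ) := rfl
    rw [hsplit, add_mulVec, one_mulVec, mulVec_sub, mulVec_smul, smul_mulVec, smul_mulVec,
      hCv, hCv]
    ext k
    simp only [Pi.add_apply, Pi.sub_apply, Pi.smul_apply, smul_eq_mul, ← hv, Complex.ofReal_add]
    linear_combination (-((B *ᵥ (B *ᵥ v)) k : ℂ)) * Complex.I_mul_I
  rw [← key, mulVec_mulVec, nonsing_inv_mul _ hu, one_mulVec]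

end Matrix

theorem re_sum_sq_sub_I_mul {n : Type*} [Fintype n] (v w : n → ℝ) :
    (∑ j, ((v j : ℂ) - Complex.I * (w j : ℂ)) ^ 2).re = ∑ j, v j ^ 2 - ∑ j, w j ^ 2 := by
  simp [pow_two]

theorem im_sum_sq_sub_I_mul {n : Type*} [Fintype n] (v w : n → ℝ) :
    (∑ j, ((v j : ℂ) - Complex.I * (w j : ℂ)) ^ 2).im = -2 * ∑ j, w j * v j := by
  rw [Complex.im_sum, Finset.mul_sum]
  refine Finset.sum_congr rfl fun j _ => ?_
  simp [pow_two]
  ring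

/-- For symmetric `B`, if `ξ = v + B² v` then `|v|² - |Bv|² = |ξ|² - 3 |Bv|² - |B² v|²`. -/
theorem Matrix.IsSymm.sum_sq_sub_sum_sq_mulVec {n : Type*} [Fintype n] {B : Matrix n n ℝ}
    (hB : B.IsSymm) {ξ v : n → ℝ} (hv : v + B *ᵥ (B *ᵥ v) = ξ) :
    ∑ j, v j ^ 2 - ∑ j, (B *ᵥ v) j ^ 2 =
      ∑ j, ξ j ^ 2 - 3 * ∑ j, (B *ᵥ v) j ^ 2 - ∑ j, (B *ᵥ (B *ᵥ v)) j ^ 2 := by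
  have hs : v ⬝ᵥ B *ᵥ (B *ᵥ v) = (B *ᵥ v) ⬝ᵥ (B *ᵥ v) := by
    rw [Matrix.dotProduct_mulVec, ← Matrix.mulVec_transpose, hB.eq]
  simp only [dotProduct] at hs
  have h : ∑ j, ξ j ^ 2 = ∑ j, v j ^ 2 + 2 * ∑ j, v j * (B *ᵥ (B *ᵥ v)) j
      + ∑ j, (B *ᵥ (B *ᵥ v)) j ^ 2 := by
    rw [Finset.mul_sum, ← Finset.sum_add_distrib, ← Finset.sum_add_distrib]
    refine Finset.sum_congr rfl fun j _ => ?_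
    rw [← hv, Pi.add_apply]
    ring
  rw [h, hs]
  simp only [pow_two]
  ring

/-- Structure of the characteristic set of the complex-scaled symbol
`p(x,ξ) = Σ_j (((I + iB(x))⁻¹ ξ)_j)²` for `B(x)` real symmetric positive semidefinite and
`C¹` in `x`: real and imaginary parts, the consequences of `Im p = 0`, and the gradients of
`Re p` on `{p = 1}` (so that there `H_{Re p} = (2ξ, 0)`). -/
theorem scaled_symbol_characteristic_set
    (d : ℕ) (hd : 1 ≤ d)
    (B : (Fin d → ℝ) → Matrix (Fin d) (Fin d) ℝ)
    (hB1 : ∀ i j : Fin d, ContDiff ℝ 1 (fun x => B x i j))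
    (hBsymm : ∀ x, (B x).IsSymm)
    (hBpsd : ∀ x, (B x).PosSemidef)
    (p : (Fin d → ℝ) × (Fin d → ℝ) → ℂ)
    (hp : ∀ ρ : (Fin d → ℝ) × (Fin d → ℝ),
      p ρ = ∑ j : Fin d,
        ((((1 : Matrix (Fin d) (Fin d) ℂ)
            + Complex.I • ((B ρ.1).map Complex.ofReal))⁻¹.mulVec
              (fun k => ((ρ.2 k : ℝ) : ℂ))) j) ^ 2) :
    ∀ x ξ : Fin d → ℝ,
      ∀ v : Fin d → ℝ, v = ((1 : Matrix (Fin d) (Fin d) ℝ) + (B x) ^ 2)⁻¹.mulVec ξ →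
      -- (a)
      ((p (x, ξ)).re = (∑ j, (v j) ^ 2) - ∑ j, ((B x).mulVec v j) ^ 2) ∧
      ((p (x, ξ)).im = -2 * ∑ j, ((B x).mulVec v j) * v j) ∧
      -- (b)
      ((p (x, ξ)).im = 0 → (B x).mulVec v = 0 ∧ v = ξ) ∧
      -- (c)
      (p (x, ξ) = 1 →
        (∑ j, (ξ j) ^ 2 = 1) ∧
        (∀ j : Fin d,
          fderiv ℝ (fun ρ => (p ρ).re) (x, ξ) (0, Pi.single j 1) = 2 * ξ j) ∧
        (∀ j : Fin d,
          fderiv ℝ (fun ρ => (p ρ).re) (x, ξ) (Pi.single j 1, 0) = 0)) := by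
  have hv (ρ : (Fin d → ℝ) × (Fin d → ℝ)) :=
    (hBpsd ρ.1).inv_one_add_sq_mulVec_add ρ.2
  have hp' (ρ : (Fin d → ℝ) × (Fin d → ℝ)) := (hp ρ).trans <| by
    rw [(hBpsd ρ.1).inv_one_add_I_smul_mulVec (hv ρ)]
  have hre (ρ : (Fin d → ℝ) × (Fin d → ℝ)) :=
    (congrArg Complex.re (hp' ρ)).trans (re_sum_sq_sub_I_mul _ _)
  rintro x ξ v rfl
  have him := (congrArg Complex.im (hp' (x, ξ))).trans (im_sum_sq_sub_I_mul _ _)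
  have hker : (p (x, ξ)).im = 0 → (B x) *ᵥ ((1 + (B x) ^ 2)⁻¹ *ᵥ ξ) = 0 ∧
      (1 + (B x) ^ 2)⁻¹ *ᵥ ξ = ξ := by
    intro h0
    have hw : (B x) *ᵥ ((1 + (B x) ^ 2)⁻¹ *ᵥ ξ) = 0 := by
      rw [← (hBpsd x).dotProduct_mulVec_zero_iff, star_trivial, dotProduct_comm]
      rw [him] at h0
      exact (mul_eq_zero.mp h0).resolve_left (by norm_num)
    refine ⟨hw, ?_⟩
    have h := hv (x, ξ)
    dsimp only at h
    rwa [hw, Matrix.mulVec_zero, add_zero] at h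
  refine ⟨hre (x, ξ), him, hker, fun h1 => ?_⟩
  obtain ⟨hw, hvξ⟩ := hker (by simp [h1])
  have hB : ∀ i j, DifferentiableAt ℝ
      (fun ρ : (Fin d → ℝ) × (Fin d → ℝ) => B ρ.1 i j) (x, ξ) := fun i j =>
    ((hB1 i j).differentiable one_ne_zero).differentiableAt.comp (x, ξ) differentiableAt_fst
  have hA : ∀ i j, DifferentiableAt ℝ
      (fun ρ : (Fin d → ℝ) × (Fin d → ℝ) =>
        ((1 : Matrix (Fin d) (Fin d) ℝ) + (B ρ.1) ^ 2) i j) (x, ξ) := by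
    intro i j
    simp only [pow_two, Matrix.add_apply, Matrix.mul_apply]
    exact (DifferentiableAt.fun_sum fun k _ => (hB i k).mul (hB k j)).const_add _
  have hvd : ∀ j, DifferentiableAt ℝ
      (fun ρ : (Fin d → ℝ) × (Fin d → ℝ) => ((1 + (B ρ.1) ^ 2)⁻¹ *ᵥ ρ.2) j) (x, ξ) :=
    DifferentiableAt.matrix_mulVec_apply
      (DifferentiableAt.matrix_inv_apply hA (hBpsd x).posDef_one_add_sq.det_pos.ne')
      fun j => by fun_prop
  have hwd := DifferentiableAt.matrix_mulVec_apply hB hvd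
  have hD1 := hasFDerivAt_sum_sq_zero hwd hw
  have hD2 := hasFDerivAt_sum_sq_zero (DifferentiableAt.matrix_mulVec_apply hB hwd)
    (by simp only [hw, Matrix.mulVec_zero])
  have hD0 : HasFDerivAt (fun ρ : (Fin d → ℝ) × (Fin d → ℝ) => ∑ j, ρ.2 j ^ 2)
      (∑ j, (2 * ξ j) • ((ContinuousLinearMap.proj (R := ℝ) (φ := fun _ : Fin d => ℝ) j).comp
        (ContinuousLinearMap.snd ℝ (Fin d → ℝ) (Fin d → ℝ)))) (x, ξ) := by
    refine HasFDerivAt.fun_sum fun j _ => ?_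
    have h := ((ContinuousLinearMap.proj (R := ℝ) (φ := fun _ : Fin d => ℝ) j).comp
        (ContinuousLinearMap.snd ℝ (Fin d → ℝ) (Fin d → ℝ))).hasFDerivAt (x := (x, ξ))
    simpa using h.pow 2
  have hD := ((hD0.sub (hD1.const_mul 3)).sub hD2).congr_of_eventuallyEq
    (f₁ := fun ρ => (p ρ).re) <| Filter.Eventually.of_forall fun ρ =>
      (hre ρ).trans ((hBsymm ρ.1).sum_sq_sub_sum_sq_mulVec (hv ρ))
  refine ⟨?_, fun j => ?_, fun j => ?_⟩
  · have h := hre (x, ξ)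
    dsimp only at h
    rw [h1, hw, hvξ] at h
    simpa using h.symm
  · rw [hD.fderiv]
    simp [Pi.single_apply]
  · rw [hD.fderiv]
    simp
end
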